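/- arXiv:2305.04700 — 3 statements merged into one kernel-verified Lean document; each statement's English description precedes it below -/
import Mathlib

section
/- Let m ≥ 1. There exists a constant C > 0 depending only on m such that for every continuously differentiable, compactly supported g : ℝ^{2m+1} → ℝ and every z = (y,v) ∈ ℍ^m, ∫_{ℝ^{2m+1}} |g(z·w) − g(w)| dw ≤ C ( ‖z‖_ℍ Σ_{j=1}^{2m} ∫_{ℝ^{2m+1}} |X_j^R g| + ‖z‖_ℍ² ∫_{ℝ^{2m+1}} |∂_u g| ), where ‖(y,v)‖_ℍ := (|y|⁴ + v²)^{1/4}, ∂_u g is the partial derivative of g in the last coordinate, and for 1 ≤ j ≤ m, X_j^R g(x,u) := ∂_{x_j} g(x,u) + (1/2) x_{m+j} ∂_u g(x,u), while for m+1 ≤ j ≤ 2m, X_j^R g(x,u) := ∂_{x_j} g(x,u) − (1/2) x_{j−m} ∂_u g(x,u). (The mean value theorem of the paper, in the case of the Heisenberg group: the X_j^R are the right-invariant vector fields and 1,…,1,2 are the dilation exponents.) -/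
open MeasureTheory ENNReal Real Filter

noncomputable section

/-- The horizontal layer `ℝ^{2m}` with the Euclidean norm. -/
abbrev Vm (m : ℕ) := EuclideanSpace ℝ (Fin (2 * m))

/-- The Heisenberg group `ℍ^m = ℝ^{2m} × ℝ` (product coordinates `(x, u)`). -/
abbrev HP (m : ℕ) := Vm m × ℝ

/-- The symplectic form `x^⊤Jy = (1/2) ∑_{j=1}^m (x_j y_{m+j} - x_{m+j} y_j)`. -/
def sympV (m : ℕ) (x y : Vm m) : ℝ :=
  (1 / 2) * ∑ j : Fin m,
    (x ⟨(j : ℕ), by omega⟩ * y ⟨m + (j : ℕ), by omega⟩ -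
      x ⟨m + (j : ℕ), by omega⟩ * y ⟨(j : ℕ), by omega⟩)

/-- The Heisenberg group product `(x,u)·(y,v) = (x + y, u + v + x^⊤Jy)`. -/
def pmul (m : ℕ) (z w : HP m) : HP m :=
  (z.1 + w.1, z.2 + w.2 + sympV m z.1 w.1)

/-- The Heisenberg group inverse `(x,u)⁻¹ = (-x,-u)`. -/
def pinv (m : ℕ) (z : HP m) : HP m := (-z.1, -z.2)

/-- The right-invariant vector fields applied to `g`: for `j < m` (i.e. `1 ≤ j ≤ m`),
`X_j^R g = ∂_{x_j} g + (1/2) x_{m+j} ∂_u g`, and for `m ≤ j < 2m` (i.e. `m+1 ≤ j ≤ 2m`),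
`X_j^R g = ∂_{x_j} g - (1/2) x_{j-m} ∂_u g`. -/
def XR (m : ℕ) (j : Fin (2 * m)) (g : HP m → ℝ) (z : HP m) : ℝ :=
  fderiv ℝ g z (EuclideanSpace.single j 1, 0) +
    (if h : (j : ℕ) < m then (1 / 2) * z.1 ⟨m + (j : ℕ), by omega⟩
      else -((1 / 2) * z.1 ⟨(j : ℕ) - m, by omega⟩)) * fderiv ℝ g z (0, 1)

/-- The Korányi norm `‖(y,v)‖_ℍ = (|y|⁴ + v²)^{1/4}`. -/
def kNorm (m : ℕ) (z : HP m) : ℝ := (‖z.1‖ ^ 4 + z.2 ^ 2) ^ ((1 : ℝ) / 4)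

/-- The coefficient of `∂_u` in the right-invariant vector field `X_j^R` at the point `(x, u)`. -/
def rightCoeff (m : ℕ) (j : Fin (2 * m)) (x : Vm m) : ℝ :=
  if h : (j : ℕ) < m then (1 / 2) * x ⟨m + (j : ℕ), by omega⟩
    else -((1 / 2) * x ⟨(j : ℕ) - m, by omega⟩)

lemma XR_eq (m : ℕ) (j : Fin (2 * m)) (g : HP m → ℝ) :
    XR m j g = fun p => fderiv ℝ g p (EuclideanSpace.single j 1, 0) +
      rightCoeff m j p.1 * fderiv ℝ g p (0, 1) := rfl

lemma continuous_rightCoeff (m : ℕ) (j : Fin (2 * m)) : Continuous (rightCoeff m j) := by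
  unfold rightCoeff
  split_ifs <;> fun_prop

lemma sympV_eq_sum_rightCoeff (m : ℕ) (x y : Vm m) :
    sympV m x y = ∑ j, x j * rightCoeff m j y := by
  have e : m + m = 2 * m := by omega
  rw [← (finCongr e).sum_comp, Fin.sum_univ_add, ← Finset.sum_add_distrib, sympV, Finset.mul_sum]
  refine Finset.sum_congr rfl fun j _ => ?_
  simp only [rightCoeff, finCongr_apply, Fin.val_cast, Fin.val_castAdd, Fin.val_natAdd, j.isLt,
    dif_pos, Nat.not_lt.mpr (Nat.le_add_right m j), dif_neg, not_false_eq_true,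
    Nat.add_sub_cancel_left]
  have h1 : Fin.cast e (Fin.castAdd m j) = ⟨(j : ℕ), by omega⟩ := rfl
  have h2 : Fin.cast e (Fin.natAdd m j) = ⟨m + (j : ℕ), by omega⟩ := rfl
  simp only [h1, h2]
  ring

lemma continuous_sympV (m : ℕ) : Continuous fun p : Vm m × Vm m => sympV m p.1 p.2 := by
  unfold sympV
  fun_prop

lemma sympV_add_right (m : ℕ) (x y y' : Vm m) :
    sympV m x (y + y') = sympV m x y + sympV m x y' := by
  simp only [sympV, PiLp.add_apply, ← mul_add, ← Finset.sum_add_distrib]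
  congr 1
  exact Finset.sum_congr rfl fun j _ => by ring

lemma sympV_smul_left (m : ℕ) (s : ℝ) (x y : Vm m) : sympV m (s • x) y = s * sympV m x y := by
  simp only [sympV, PiLp.smul_apply, smul_eq_mul, Finset.mul_sum]
  exact Finset.sum_congr rfl fun j _ => by ring

lemma sympV_smul_right (m : ℕ) (s : ℝ) (x y : Vm m) : sympV m x (s • y) = s * sympV m x y := by
  simp only [sympV, PiLp.smul_apply, smul_eq_mul, Finset.mul_sum]
  exact Finset.sum_congr rfl fun j _ => by ring

lemma sympV_self (m : ℕ) (x : Vm m) : sympV m x x = 0 := by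
  simp [sympV, mul_comm]

/-- The derivative of `g` along the right-invariant vector field generated by `z = (y, v)`. -/
def rightDeriv (m : ℕ) (g : HP m → ℝ) (z p : HP m) : ℝ :=
  fderiv ℝ g p (z.1, z.2 + sympV m z.1 p.1)

lemma rightDeriv_eq_sum (m : ℕ) (g : HP m → ℝ) (z p : HP m) :
    rightDeriv m g z p =
      ∑ j, z.1 j * XR m j g p + z.2 * fderiv ℝ g p ((0 : Vm m), (1 : ℝ)) := by
  have hz : (∑ j, z.1 j • EuclideanSpace.single j (1 : ℝ) : Vm m) = z.1 := by
    ext i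
    simp [Pi.single_apply]
  have h : ((z.1, z.2 + sympV m z.1 p.1) : HP m) =
      ∑ j, z.1 j • ((EuclideanSpace.single j (1 : ℝ), 0) : HP m) +
        (z.2 + sympV m z.1 p.1) • ((0 : Vm m), (1 : ℝ)) := by
    refine Prod.ext ?_ ?_
    · simp [Prod.fst_sum, hz]
    · simp [Prod.snd_sum]
  rw [rightDeriv, h, map_add, map_sum, map_smul]
  simp only [map_smul, smul_eq_mul, XR_eq, mul_add, Finset.sum_add_distrib, add_mul,
    sympV_eq_sum_rightCoeff, Finset.sum_mul, mul_assoc]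
  ring

lemma hasDerivAt_pmul_smul (m : ℕ) (z w : HP m) (s : ℝ) :
    HasDerivAt (fun t : ℝ => pmul m (t • z) w)
      (z.1, z.2 + sympV m z.1 (pmul m (s • z) w).1) s := by
  have h1 : HasDerivAt (fun t : ℝ => t • z.1 + w.1) z.1 s := by
    simpa using ((hasDerivAt_id s).smul_const z.1).add_const w.1
  have h2 : HasDerivAt (fun t : ℝ => t * z.2 + w.2 + t * sympV m z.1 w.1)
      (z.2 + sympV m z.1 w.1) s := by
    simpa using (((hasDerivAt_id s).mul_const z.2).add_const w.2).fun_add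
      ((hasDerivAt_id s).mul_const (sympV m z.1 w.1))
  have h := h1.prodMk h2
  simpa [pmul, sympV_smul_left, sympV_add_right, sympV_smul_right, sympV_self] using h

lemma continuous_pmul (m : ℕ) : Continuous fun p : HP m × HP m => pmul m p.1 p.2 := by
  have h : Continuous fun p : HP m × HP m => sympV m p.1.1 p.2.1 :=
    (continuous_sympV m).comp (by fun_prop : Continuous fun p : HP m × HP m => (p.1.1, p.2.1))
  unfold pmul
  fun_prop

lemma continuous_rightDeriv {m : ℕ} {g : HP m → ℝ} (hg : ContDiff ℝ 1 g) (z : HP m) :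
    Continuous (rightDeriv m g z) := by
  have h : Continuous fun p : HP m => sympV m z.1 p.1 :=
    (continuous_sympV m).comp (by fun_prop : Continuous fun p : HP m => (z.1, p.1))
  exact (hg.continuous_fderiv one_ne_zero).clm_apply (by fun_prop)

lemma measurePreserving_pmul (m : ℕ) (z : HP m) : MeasurePreserving (pmul m z) := by
  refine MeasurePreserving.skew_product (g := fun x u => z.2 + u + sympV m z.1 x)
    (measurePreserving_add_left volume z.1) ?_ ?_
  · have h : Continuous fun p : Vm m × ℝ => sympV m z.1 p.1 :=
      (continuous_sympV m).comp (by fun_prop : Continuous fun p : Vm m × ℝ => (z.1, p.1))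
    exact Continuous.measurable (by simp only [Function.uncurry_def]; fun_prop)
  · refine Eventually.of_forall fun x => ?_
    have h : (fun u : ℝ => z.2 + u + sympV m z.1 x) = fun u => z.2 + sympV m z.1 x + u := by
      ext u
      ring
    rw [h]
    exact (measurePreserving_add_left (volume : Measure ℝ) (z.2 + sympV m z.1 x)).map_eq

lemma integrable_XR {m : ℕ} {g : HP m → ℝ} (hg : ContDiff ℝ 1 g) (hc : HasCompactSupport g)
    (j : Fin (2 * m)) : Integrable (XR m j g) := by
  have hf := hg.continuous_fderiv one_ne_zero
  rw [XR_eq]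
  refine Continuous.integrable_of_hasCompactSupport ?_ ?_
  · exact (hf.clm_apply continuous_const).add
      (((continuous_rightCoeff m j).comp continuous_fst).mul (hf.clm_apply continuous_const))
  · exact (hc.fderiv_apply ℝ _).add (hc.fderiv_apply ℝ _).mul_left

lemma integrable_fderiv_snd {m : ℕ} {g : HP m → ℝ} (hg : ContDiff ℝ 1 g)
    (hc : HasCompactSupport g) :
    Integrable fun w : HP m => fderiv ℝ g w ((0 : Vm m), (1 : ℝ)) :=
  Continuous.integrable_of_hasCompactSupport
    ((hg.continuous_fderiv one_ne_zero).clm_apply continuous_const) (hc.fderiv_apply ℝ _)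

lemma enorm_sub_le_lintegral_rightDeriv {m : ℕ} {g : HP m → ℝ} (hg : ContDiff ℝ 1 g)
    (z w : HP m) :
    ‖g (pmul m z w) - g w‖ₑ ≤
      ∫⁻ s in Set.Ioc (0 : ℝ) 1, ‖rightDeriv m g z (pmul m (s • z) w)‖ₑ := by
  have hcont : Continuous fun s : ℝ => rightDeriv m g z (pmul m (s • z) w) :=
    (continuous_rightDeriv hg z).comp ((continuous_pmul m).comp
      (by fun_prop : Continuous fun s : ℝ => (s • z, w)))
  have hderiv (s : ℝ) : HasDerivAt (fun t : ℝ => g (pmul m (t • z) w))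
      (rightDeriv m g z (pmul m (s • z) w)) s :=
    ((hg.differentiable one_ne_zero _).hasFDerivAt).comp_hasDerivAt s
      (hasDerivAt_pmul_smul m z w s)
  have hint := intervalIntegral.integral_eq_sub_of_hasDerivAt (a := 0) (b := 1)
    (fun s _ => hderiv s) (hcont.intervalIntegrable 0 1)
  have h0 : pmul m ((0 : ℝ) • z) w = w := by
    simp [pmul, sympV]
  rw [one_smul, h0] at hint
  rw [← hint, intervalIntegral.integral_of_le zero_le_one]
  exact enorm_integral_le_lintegral_enorm _

lemma lintegral_enorm_sub_le {m : ℕ} {g : HP m → ℝ} (hg : ContDiff ℝ 1 g) (z : HP m) :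
    ∫⁻ w, ‖g (pmul m z w) - g w‖ₑ ≤ ∫⁻ w, ‖rightDeriv m g z w‖ₑ := by
  have hR := continuous_rightDeriv hg z
  have hcont : Continuous fun p : HP m × ℝ => rightDeriv m g z (pmul m (p.2 • z) p.1) :=
    hR.comp ((continuous_pmul m).comp
      (by fun_prop : Continuous fun p : HP m × ℝ => (p.2 • z, p.1)))
  calc ∫⁻ w, ‖g (pmul m z w) - g w‖ₑ
      ≤ ∫⁻ w, ∫⁻ s in Set.Ioc (0 : ℝ) 1, ‖rightDeriv m g z (pmul m (s • z) w)‖ₑ :=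
        lintegral_mono (enorm_sub_le_lintegral_rightDeriv hg z)
    _ = ∫⁻ s in Set.Ioc (0 : ℝ) 1, ∫⁻ w, ‖rightDeriv m g z (pmul m (s • z) w)‖ₑ :=
        lintegral_lintegral_swap hcont.enorm.measurable.aemeasurable
    _ = ∫⁻ _ in Set.Ioc (0 : ℝ) 1, ∫⁻ w, ‖rightDeriv m g z w‖ₑ := by
        congr 1 with s
        exact (measurePreserving_pmul m (s • z)).lintegral_comp hR.enorm.measurable
    _ = ∫⁻ w, ‖rightDeriv m g z w‖ₑ := by simp

lemma kNorm_nonneg (m : ℕ) (z : HP m) : 0 ≤ kNorm m z := by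
  unfold kNorm
  positivity

lemma kNorm_pow_four (m : ℕ) (z : HP m) : kNorm m z ^ 4 = ‖z.1‖ ^ 4 + z.2 ^ 2 := by
  rw [kNorm, ← Real.rpow_natCast, ← Real.rpow_mul (by positivity)]
  norm_num

lemma norm_fst_le_kNorm (m : ℕ) (z : HP m) : ‖z.1‖ ≤ kNorm m z := by
  refine le_of_pow_le_pow_left₀ four_ne_zero (kNorm_nonneg m z) ?_
  rw [kNorm_pow_four]
  linarith [sq_nonneg z.2]

lemma abs_snd_le_kNorm_sq (m : ℕ) (z : HP m) : |z.2| ≤ kNorm m z ^ 2 := by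
  refine abs_le_of_sq_le_sq ?_ (by positivity)
  rw [← pow_mul, kNorm_pow_four]
  linarith [pow_nonneg (norm_nonneg z.1) 4]

lemma abs_rightDeriv_le (m : ℕ) (g : HP m → ℝ) (z p : HP m) :
    |rightDeriv m g z p| ≤ kNorm m z * ∑ j, |XR m j g p| +
      kNorm m z ^ 2 * |fderiv ℝ g p ((0 : Vm m), (1 : ℝ))| := by
  rw [rightDeriv_eq_sum, Finset.mul_sum]
  refine (abs_add_le _ _).trans (add_le_add ?_ ?_)
  · refine (Finset.abs_sum_le_sum_abs _ _).trans (Finset.sum_le_sum fun j _ => ?_)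
    rw [abs_mul]
    gcongr
    exact (PiLp.norm_apply_le z.1 j).trans (norm_fst_le_kNorm m z)
  · rw [abs_mul]
    gcongr
    exact abs_snd_le_kNorm_sq m z

/-- **Mean value theorem on the Heisenberg group:** for `C¹`, compactly supported `g`
and any `z ∈ ℍ^m`,
`∫ |g(z·w) - g(w)| dw ≲ ‖z‖_ℍ ∑_j ∫ |X_j^R g| + ‖z‖_ℍ² ∫ |∂_u g|`. -/
theorem heisenberg_mean_value_theorem (m : ℕ) (hm : 1 ≤ m) :
    ∃ C : ℝ, 0 < C ∧
      ∀ g : HP m → ℝ, ContDiff ℝ 1 g → HasCompactSupport g → ∀ z : HP m,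
        (∫ w, |g (pmul m z w) - g w|) ≤
          C * (kNorm m z * ∑ j : Fin (2 * m), (∫ w, |XR m j g w|) +
            kNorm m z ^ 2 * ∫ w : HP m, |fderiv ℝ g w ((0 : Vm m), (1 : ℝ))|) := by
  refine ⟨1, one_pos, fun g hg hc z => ?_⟩
  have hX (j : Fin (2 * m)) := (integrable_XR hg hc j).abs
  have hU := (integrable_fderiv_snd hg hc).abs
  have hXs : Integrable fun w => kNorm m z * ∑ j, |XR m j g w| :=
    (integrable_finsetSum _ fun j _ => hX j).const_mul _
  have hbound := hXs.add (hU.const_mul (kNorm m z ^ 2))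
  have hR : Integrable (rightDeriv m g z) :=
    hbound.mono' (continuous_rightDeriv hg z).aestronglyMeasurable
      (Eventually.of_forall (abs_rightDeriv_le m g z))
  have hdiff : Continuous fun w => g (pmul m z w) - g w :=
    (hg.continuous.comp ((continuous_pmul m).comp
      (by fun_prop : Continuous fun w : HP m => (z, w)))).sub hg.continuous
  calc ∫ w, |g (pmul m z w) - g w|
      = (∫⁻ w, ‖g (pmul m z w) - g w‖ₑ).toReal :=
        integral_norm_eq_lintegral_enorm hdiff.aestronglyMeasurable
    _ ≤ (∫⁻ w, ‖rightDeriv m g z w‖ₑ).toReal :=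
        ENNReal.toReal_mono hR.2.ne (lintegral_enorm_sub_le hg z)
    _ = ∫ w, |rightDeriv m g z w| := (integral_norm_eq_lintegral_enorm hR.1).symm
    _ ≤ ∫ w, (kNorm m z * ∑ j, |XR m j g w| +
          kNorm m z ^ 2 * |fderiv ℝ g w ((0 : Vm m), (1 : ℝ))|) :=
        integral_mono hR.abs hbound (abs_rightDeriv_le m g z)
    _ = _ := by
        rw [integral_add hXs (hU.const_mul _), integral_const_mul, integral_const_mul,
          integral_finsetSum _ fun j _ => hX j, one_mul]
end
end

section
/- Let 𝔤 be a finite-dimensional real Lie algebra admitting a grading (V_j)_{j ≥ 1}, and suppose dim 𝔤 ≥ 2. Then for every X ∈ 𝔤, the kernel of ad X (i.e. the subspace {Y ∈ 𝔤 : ⁅X, Y⁆ = 0}) has dimension at least 2. -/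
noncomputable section

/-- A nontrivial Lie algebra graded in positive degrees, with finitely many nonzero
components, has a nonzero central element. -/
theorem exists_ne_zero_central_of_graded
    {R L : Type*} [CommRing R] [LieRing L] [LieAlgebra R L] [Nontrivial L]
    (V : ℕ → Submodule R L) (hV0 : V 0 = ⊥) (hsup : iSup V = ⊤)
    (hfin : {j | V j ≠ ⊥}.Finite)
    (hbracket : ∀ i j : ℕ, ∀ x ∈ V i, ∀ y ∈ V j, ⁅x, y⁆ ∈ V (i + j)) :
    ∃ z : L, z ≠ 0 ∧ ∀ x : L, ⁅x, z⁆ = 0 := by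
  have hne : {j | V j ≠ ⊥}.Nonempty := by
    by_contra h
    have hbot : ∀ j, V j = ⊥ := fun j => by
      by_contra hj
      exact h ⟨j, hj⟩
    rw [iSup_eq_bot.mpr hbot] at hsup
    exact bot_ne_top hsup
  obtain ⟨m, hm, hmax⟩ := Set.exists_max_image _ id hfin hne
  obtain ⟨z, hz, hz0⟩ := (V m).ne_bot_iff.mp hm
  refine ⟨z, hz0, fun x => ?_⟩
  have hx : x ∈ iSup V := hsup ▸ Submodule.mem_top
  induction hx using Submodule.iSup_induction' with
  | zero => exact zero_lie z
  | add x y _ _ hx hy => rw [add_lie, hx, hy, add_zero]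
  | mem i x hx =>
    by_contra h
    have hi : i ≠ 0 := by
      rintro rfl
      rw [hV0, Submodule.mem_bot] at hx
      exact h (by rw [hx, zero_lie])
    have hle : i + m ≤ m :=
      hmax (i + m) ((V (i + m)).ne_bot_iff.mpr ⟨_, hbracket i m x hx z hz, h⟩)
    omega

/-- In a Lie algebra of dimension at least `2` with a nonzero central element, the kernel of
every adjoint map has dimension at least `2`. -/
theorem two_le_finrank_ker_ad_of_central
    {K L : Type*} [Field K] [LieRing L] [LieAlgebra K L] [Module.Finite K L]
    (hdim : 2 ≤ Module.finrank K L) {z : L} (hz0 : z ≠ 0) (hz : ∀ x : L, ⁅x, z⁆ = 0)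
    (X : L) : 2 ≤ Module.finrank K ↥(LinearMap.ker ((LieAlgebra.ad K L) X)) := by
  by_cases hX : ∃ a : K, a • z = X
  · obtain ⟨a, rfl⟩ := hX
    have hker : LinearMap.ker ((LieAlgebra.ad K L) (a • z)) = ⊤ := by
      refine (Submodule.eq_top_iff').mpr fun y => ?_
      rw [LinearMap.mem_ker, LieAlgebra.ad_apply, smul_lie, ← lie_skew, hz, neg_zero, smul_zero]
    rwa [hker, finrank_top]
  · have hli : LinearIndependent K ![z, X] :=
      (LinearIndependent.pair_iff' hz0).mpr fun a ha => hX ⟨a, ha⟩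
    have hspan : Submodule.span K (Set.range ![z, X]) ≤
        LinearMap.ker ((LieAlgebra.ad K L) X) := by
      rw [Submodule.span_le]
      rintro _ ⟨i, rfl⟩
      fin_cases i
      · exact hz X
      · exact lie_self X
    simpa [finrank_span_eq_card hli] using Submodule.finrank_mono hspan

/-- **Kernels of adjoint maps in graded Lie algebras are at least 2-dimensional.**
If a finite-dimensional real Lie algebra `𝔤` of dimension at least `2` admits a grading
`𝔤 = ⊕_{j ≥ 1} V_j` with `⁅V_i, V_j⁆ ⊆ V_{i+j}`, then for every `X ∈ 𝔤` the kernel of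
`ad X : Y ↦ ⁅X, Y⁆` has dimension at least `2`. (The grading is encoded as a family
`V : ℕ → Submodule ℝ L` with `V 0 = ⊥`, whose internal direct sum is `𝔤`.) -/
theorem ker_ad_two_dimensional_of_graded
    (L : Type*) [LieRing L] [LieAlgebra ℝ L] [Module.Finite ℝ L]
    (hdim : 2 ≤ Module.finrank ℝ L)
    (V : ℕ → Submodule ℝ L) (hV0 : V 0 = ⊥)
    (hinternal : DirectSum.IsInternal V)
    (hbracket : ∀ i j : ℕ, ∀ x ∈ V i, ∀ y ∈ V j, ⁅x, y⁆ ∈ V (i + j)) :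
    ∀ X : L, 2 ≤ Module.finrank ℝ ↥(LinearMap.ker ((LieAlgebra.ad ℝ L) X)) := by
  intro X
  have : Nontrivial L := Module.nontrivial_of_finrank_pos (R := ℝ) (by omega)
  obtain ⟨z, hz0, hz⟩ := exists_ne_zero_central_of_graded V hV0 hinternal.submodule_iSup_eq_top
    (WellFoundedGT.finite_ne_bot_of_iSupIndep hinternal.submodule_iSupIndep) hbracket
  exact two_le_finrank_ker_ad_of_central hdim hz0 hz X
end
end

section
/- Let m ≥ 1 and S ⊆ ℍ^m. Then the subgroup of ℍ^m generated by S equals all of ℍ^m if and only if the subgroup of the additive group (ℝ^{2m}, +) generated by the projection {x ∈ ℝ^{2m} : (x,u) ∈ S for some u ∈ ℝ} equals all of ℝ^{2m}. (This is the generator test lemma of the paper in the case of the stratified group G = ℍ^m, for which, in exponential coordinates, Π₁ ∘ exp⁻¹(x,u) = x and V₁ = ℝ^{2m}.) -/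
open MeasureTheory ENNReal Real Filter

noncomputable section

/-- Membership in the subgroup of `ℍ^m` generated by `S`: the smallest set containing
`S` and the identity and closed under the group inverse and product. -/
inductive InGen (m : ℕ) (S : Set (HP m)) : HP m → Prop where
  | mem {s : HP m} (hs : s ∈ S) : InGen m S s
  | ident : InGen m S 0
  | inv {s : HP m} (hs : InGen m S s) : InGen m S (pinv m s)
  | mul {s t : HP m} (hs : InGen m S s) (ht : InGen m S t) : InGen m S (pmul m s t)

theorem sympV_swap (m : ℕ) (x y : Vm m) : sympV m y x = -sympV m x y := by
  unfold sympV
  rw [← mul_neg, ← Finset.sum_neg_distrib]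
  congr 1
  exact Finset.sum_congr rfl fun j _ => by ring

theorem sympV_self_neg (m : ℕ) (x : Vm m) : sympV m x (-x) = 0 := by
  unfold sympV
  rw [Finset.sum_eq_zero, mul_zero]
  intro j _
  simp only [PiLp.neg_apply]
  ring

theorem sympV_zero_right (m : ℕ) (x : Vm m) : sympV m x 0 = 0 := by
  simp [sympV]

/-- The commutator of `z` and `w` is the central element `(0, 2 x^⊤Jy)`. -/
theorem pmul_commutator (m : ℕ) (z w : HP m) :
    pmul m (pmul m z w) (pinv m (pmul m w z)) = (0, 2 * sympV m z.1 w.1) := by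
  have h : sympV m (z.1 + w.1) (-(w.1 + z.1)) = 0 := by
    rw [add_comm w.1 z.1, sympV_self_neg]
  refine Prod.ext ?_ ?_
  · simp only [pmul, pinv]
    abel
  · simp only [pmul, pinv, h, sympV_swap m z.1 w.1]
    ring

/-- The symplectic form is onto `ℝ` when `m ≥ 1`. -/
theorem exists_sympV_eq (m : ℕ) (hm : 1 ≤ m) (t : ℝ) : ∃ x y : Vm m, sympV m x y = t := by
  refine ⟨EuclideanSpace.single ⟨0, by omega⟩ (2 * t), EuclideanSpace.single ⟨m, by omega⟩ 1, ?_⟩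
  unfold sympV
  rw [Finset.sum_eq_single (⟨0, hm⟩ : Fin m)]
  · have h : m ≠ 0 := by omega
    simp [h, h.symm]
  · intro j _ hj
    have h : (j : ℕ) ≠ 0 := fun h => hj (Fin.ext h)
    have h' : m ≠ 0 := by omega
    simp [h, h']
  · simp

theorem InGen.fst_mem_closure {m : ℕ} {S : Set (HP m)} {z : HP m} (h : InGen m S z) :
    z.1 ∈ AddSubgroup.closure (Prod.fst '' S) := by
  induction h with
  | mem hs => exact AddSubgroup.subset_closure ⟨_, hs, rfl⟩
  | ident => exact zero_mem _
  | inv _ ih => exact neg_mem ih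
  | mul _ _ ihs iht => exact add_mem ihs iht

theorem exists_inGen_of_mem_closure {m : ℕ} {S : Set (HP m)} {x : Vm m}
    (h : x ∈ AddSubgroup.closure (Prod.fst '' S)) : ∃ u : ℝ, InGen m S (x, u) := by
  induction h using AddSubgroup.closure_induction with
  | mem x hx =>
    obtain ⟨⟨x, u⟩, hs, rfl⟩ := hx
    exact ⟨u, .mem hs⟩
  | zero => exact ⟨0, .ident⟩
  | add x y _ _ hx hy =>
    obtain ⟨u, hu⟩ := hx
    obtain ⟨v, hv⟩ := hy
    exact ⟨_, hu.mul hv⟩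
  | neg x _ hx =>
    obtain ⟨u, hu⟩ := hx
    exact ⟨_, hu.inv⟩

/-- **Generator test for the Heisenberg group:** a set `S ⊆ ℍ^m` generates `ℍ^m` as a
group if and only if its projection to the horizontal layer `ℝ^{2m}` generates
`(ℝ^{2m}, +)` as an additive group. -/
theorem heisenberg_generator_test (m : ℕ) (hm : 1 ≤ m) (S : Set (HP m)) :
    (∀ z : HP m, InGen m S z) ↔ AddSubgroup.closure (Prod.fst '' S) = ⊤ := by
  refine ⟨fun h => ?_, fun h z => ?_⟩
  · exact (AddSubgroup.eq_top_iff' _).2 fun x => (h (x, 0)).fst_mem_closure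
  · have lift (x : Vm m) : ∃ u : ℝ, InGen m S (x, u) :=
      exists_inGen_of_mem_closure (h ▸ AddSubgroup.mem_top x)
    obtain ⟨x, u⟩ := z
    obtain ⟨u', hu'⟩ := lift x
    obtain ⟨a, b, hab⟩ := exists_sympV_eq m hm ((u - u') / 2)
    obtain ⟨p, hp⟩ := lift a
    obtain ⟨q, hq⟩ := lift b
    have key := hu'.mul ((hp.mul hq).mul (hq.mul hp).inv)
    rw [pmul_commutator] at key
    convert key using 1
    refine Prod.ext ?_ ?_
    · simp [pmul]
    · simp only [pmul, sympV_zero_right, hab]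
      ring
end
end
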